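/- arXiv:2509.01159 — 3 statements merged into one kernel-verified Lean document; each statement's English description precedes it below -/
import Mathlib

section
/- Let K = {x ∈ ℝ^n : A_0 + x_1 A_1 + ... + x_n A_n ⪰ 0}, where A_0,...,A_n are q×q symmetric real matrices, and let K° = {u ∈ ℝ^n : uᵀx ≤ 1 for all x ∈ K} denote the polar of K. If the origin 0 is an interior point of K, then K° = { −(⟨U,A_1⟩, ..., ⟨U,A_n⟩) : U is a q×q positive semidefinite real matrix with ⟨U,A_0⟩ ≤ 1 }. -/
open scoped BigOperators

noncomputable section

/-- Trace inner product `⟨A, B⟩ = tr(Aᵀ B) = ∑ᵢⱼ Aᵢⱼ Bᵢⱼ` of two real matrices. -/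
def tipR {ι : Type*} [Fintype ι] (A B : Matrix ι ι ℝ) : ℝ :=
  ∑ i, ∑ j, A i j * B i j

section

open Matrix

variable {ι : Type*}

theorem Matrix.PosSemidef.transpose_eq {U : Matrix ι ι ℝ} (hU : U.PosSemidef) : Uᵀ = U := by
  simpa [IsHermitian] using hU.isHermitian

variable [Fintype ι]

theorem tipR_eq_trace {U : Matrix ι ι ℝ} (hU : U.PosSemidef) (M : Matrix ι ι ℝ) :
    tipR U M = (U * M).trace := by
  conv_rhs => rw [← hU.transpose_eq]
  simp only [tipR, trace, diag, mul_apply, transpose_apply]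
  exact Finset.sum_comm

/-- The trace inner product of two positive semidefinite matrices is nonnegative. -/
theorem Matrix.PosSemidef.trace_mul_nonneg {U M : Matrix ι ι ℝ} (hU : U.PosSemidef)
    (hM : M.PosSemidef) : 0 ≤ (U * M).trace := by
  classical
  open scoped MatrixOrder in
  obtain ⟨C, rfl⟩ := CStarAlgebra.nonneg_iff_eq_star_mul_self.mp hU.nonneg
  rw [star_eq_conjTranspose, Matrix.mul_assoc, trace_mul_comm]
  exact (hM.mul_mul_conjTranspose_same C).trace_nonneg

/-- A positive semidefinite matrix factors as `B * B`, and `B` has a symmetric generalized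
inverse `T`. -/
theorem Matrix.PosSemidef.exists_sqrt_pinv [DecidableEq ι] {M : Matrix ι ι ℝ}
    (hM : M.PosSemidef) : ∃ B T : Matrix ι ι ℝ, Bᵀ = B ∧ Tᵀ = T ∧ B * B = M ∧
      (1 - T * M * T).PosSemidef ∧ M * (T * B) = M := by
  set d := hM.1.eigenvalues
  have hd : ∀ i, 0 ≤ d i := hM.eigenvalues_nonneg
  set V := hM.1.eigenvectorUnitary
  let φ := Unitary.conjStarAlgAut ℝ (Matrix ι ι ℝ) V
  have hMφ : M = φ (diagonal d) := hM.1.spectral_theorem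
  have hsymm : ∀ e : ι → ℝ, (φ (diagonal e))ᵀ = φ (diagonal e) := fun e => by
    have := map_star φ (diagonal e)
    simpa [star_eq_conjTranspose] using this.symm
  refine ⟨φ (diagonal fun i => √(d i)), φ (diagonal fun i => (√(d i))⁻¹), hsymm _, hsymm _,
    ?_, ?_, ?_⟩
  · rw [hMφ, ← map_mul, diagonal_mul_diagonal]
    simp [Real.mul_self_sqrt (hd _)]
  · rw [hMφ, ← map_mul, ← map_mul, ← map_one φ, ← map_sub, diagonal_mul_diagonal,
      diagonal_mul_diagonal, ← diagonal_one, diagonal_sub, Unitary.conjStarAlgAut_apply]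
    refine PosSemidef.mul_mul_conjTranspose_same (PosSemidef.diagonal fun i => ?_) _
    rcases eq_or_ne (√(d i)) 0 with h | h
    · simp [h]
    · have : (√(d i))⁻¹ * d i * (√(d i))⁻¹ = 1 := by
        nth_rw 2 [← Real.mul_self_sqrt (hd i)]
        field_simp
      simp [this]
  · rw [hMφ, ← map_mul, ← map_mul, diagonal_mul_diagonal, diagonal_mul_diagonal]
    congr 2
    ext i
    rcases eq_or_ne (√(d i)) 0 with h | h
    · simp [(Real.sqrt_eq_zero (hd i)).mp h]
    · simp [h]

theorem Matrix.PosSemidef.abs_apply_le_trace {W : Matrix ι ι ℝ} (hW : W.PosSemidef)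
    (i j : ι) : |W i j| ≤ W.trace := by
  classical
  have hdiag : ∀ k, W k k ≤ W.trace := fun k =>
    Finset.single_le_sum (f := fun k => W k k) (fun _ _ => hW.diag_nonneg) (Finset.mem_univ k)
  have hs : W j i = W i j := congrFun (congrFun hW.transpose_eq i) j
  have h1 := hW.dotProduct_mulVec_nonneg (Pi.single i 1 + Pi.single j 1)
  have h2 := hW.dotProduct_mulVec_nonneg (Pi.single i 1 - Pi.single j 1)
  simp [mulVec_add, mulVec_sub, add_dotProduct, sub_dotProduct] at h1 h2
  rw [abs_le]
  constructor <;> linarith [hdiag i, hdiag j]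

theorem isCompact_setOf_posSemidef_trace_le (c : ℝ) :
    IsCompact {W : Matrix ι ι ℝ | W.PosSemidef ∧ W.trace ≤ c} := by
  have hbox : IsCompact (Set.univ.pi fun _ : ι => Set.univ.pi fun _ : ι => Set.Icc (-c) c) :=
    isCompact_univ_pi fun _ => isCompact_univ_pi fun _ => isCompact_Icc
  refine IsCompact.of_isClosed_subset hbox ?_ ?_
  · have : {W : Matrix ι ι ℝ | W.PosSemidef ∧ W.trace ≤ c} =
        {W | Wᵀ = W} ∩ (⋂ x : ι → ℝ, {W | 0 ≤ x ⬝ᵥ (W *ᵥ x)}) ∩ {W | W.trace ≤ c} := by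
      ext W
      simp [posSemidef_iff_dotProduct_mulVec, IsHermitian]
    rw [this]
    refine ((isClosed_eq (by fun_prop) (by fun_prop)).inter
      (isClosed_iInter fun x => isClosed_le (by fun_prop) (by fun_prop))).inter
      (isClosed_le (by fun_prop) (by fun_prop))
  · rintro W ⟨hW, hc⟩ i - j -
    exact abs_le.mp ((hW.abs_apply_le_trace i j).trans hc)

/-- If `M` can be perturbed both ways along `N` inside the positive semidefinite cone, then the
kernel of `M` is contained in the kernel of `N`. -/
theorem mulVec_eq_zero_of_posSemidef_perturb {M N : Matrix ι ι ℝ} {ε : ℝ} (hε : 0 < ε)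
    (hadd : (M + ε • N).PosSemidef) (hsub : (M + (-ε) • N).PosSemidef)
    {x : ι → ℝ} (hx : M *ᵥ x = 0) : N *ᵥ x = 0 := by
  have h1 := hadd.dotProduct_mulVec_nonneg x
  have h2 := hsub.dotProduct_mulVec_nonneg x
  have h3 := (hadd.dotProduct_mulVec_zero_iff x).mp
  simp only [add_mulVec, hx, smul_mulVec, dotProduct_smul, zero_add, neg_smul, smul_eq_mul,
    neg_mulVec, dotProduct_neg] at h1 h2 h3
  exact (smul_eq_zero.mp (h3 (by linarith))).resolve_left hε.ne'

end

open Matrix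

/-- **Polar of a spectrahedron.**  If `K = {x : A₀ + ∑ xₗ Aₗ ⪰ 0}` with the `Aₗ`
symmetric and `0` is an interior point of `K`, then the polar
`K° = {u : uᵀx ≤ 1 ∀ x ∈ K}` equals
`{ -(⟨U,A₁⟩, …, ⟨U,Aₙ⟩) : U ⪰ 0, ⟨U,A₀⟩ ≤ 1 }`. -/
theorem polar_of_spectrahedron {n q : ℕ}
    (A0 : Matrix (Fin q) (Fin q) ℝ) (A : Fin n → Matrix (Fin q) (Fin q) ℝ)
    (hA0 : A0.IsSymm) (hA : ∀ l, (A l).IsSymm)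
    (K : Set (Fin n → ℝ))
    (hK : K = {x | (A0 + ∑ l, x l • A l).PosSemidef})
    (h0 : (0 : Fin n → ℝ) ∈ interior K) :
    {u : Fin n → ℝ | ∀ x ∈ K, ∑ l, u l * x l ≤ 1} =
      {v : Fin n → ℝ | ∃ U : Matrix (Fin q) (Fin q) ℝ,
        U.PosSemidef ∧ tipR U A0 ≤ 1 ∧ v = fun l => -(tipR U (A l))} := by
  classical
  ext u
  simp only [Set.mem_ofPred_eq]
  constructor
  · intro hu
    have hPSD0 : A0.PosSemidef := by
      have := interior_subset h0
      rw [hK] at this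
      simpa using this
    have hker : ∀ l (x : Fin q → ℝ), A0 *ᵥ x = 0 → A l *ᵥ x = 0 := by
      intro l x hx
      obtain ⟨r, hr, hball⟩ := Metric.isOpen_iff.mp isOpen_interior 0 h0
      have hmem : ∀ t : ℝ, |t| < r → (A0 + t • A l).PosSemidef := by
        intro t ht
        have : (Pi.single l t : Fin n → ℝ) ∈ K :=
          interior_subset (hball (by simpa [Pi.norm_single] using ht))
        rw [hK] at this
        simpa [Pi.single_apply, ite_smul] using this
      have hr2 : |r / 2| < r := by rw [abs_of_pos (by positivity)]; linarith
      exact mulVec_eq_zero_of_posSemidef_perturb (half_pos hr) (hmem _ hr2)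
        (hmem _ (by rwa [abs_neg])) hx
    obtain ⟨B, T, hB, hT, hBB, hT1, hTB⟩ := hPSD0.exists_sqrt_pinv
    have hATB : ∀ l, A l * (T * B) = A l := by
      intro l
      refine ext_of_mulVec_single fun j => ?_
      have := hker l ((T * B) *ᵥ Pi.single j 1 - Pi.single j 1)
        (by rw [mulVec_sub, mulVec_mulVec, hTB, sub_self])
      rwa [mulVec_sub, mulVec_mulVec, sub_eq_zero] at this
    let g : Matrix (Fin q) (Fin q) ℝ →ₗ[ℝ] (Fin n → ℝ) :=
      { toFun := fun W l => -(T * W * T * A l).trace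
        map_add' := fun W W' => by
          ext l
          simp [Matrix.mul_add, Matrix.add_mul, add_comm]
        map_smul' := fun c W => by
          ext l
          simp }
    have hgapp : ∀ W l, g W l = -(T * W * T * A l).trace := fun _ _ => rfl
    set S := {W : Matrix (Fin q) (Fin q) ℝ | W.PosSemidef ∧ W.trace ≤ 1}
    have hSconv : Convex ℝ S := by
      rintro W ⟨hW, hWt⟩ W' ⟨hW', hWt'⟩ a b ha hb hab
      refine ⟨(hW.smul ha).add (hW'.smul hb), ?_⟩
      simp only [trace_add, trace_smul, smul_eq_mul]
      nlinarith
    have hgcont : Continuous g := continuous_pi fun l => by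
      simp only [hgapp]
      fun_prop
    have hcomp : IsCompact (g '' S) := (isCompact_setOf_posSemidef_trace_le 1).image hgcont
    have hmem : u ∈ g '' S := by
      by_contra hnot
      obtain ⟨f, s, hfs, hsu⟩ :=
        geometric_hahn_banach_closed_point (hSconv.linear_image g) hcomp.isClosed hnot
      have hs : 0 < s := by
        have := hfs (g 0) ⟨0, ⟨PosSemidef.zero, by simp⟩, rfl⟩
        simpa using this
      set x : Fin n → ℝ := fun l => f (Pi.single l 1) with hx
      have hf : ∀ v, f v = ∑ l, v l * x l := fun v => by
        refine ((f : (Fin n → ℝ) →ₗ[ℝ] ℝ).pi_apply_eq_sum_univ v).trans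
          (Finset.sum_congr rfl fun l _ => ?_)
        have : (fun j => if l = j then (1 : ℝ) else 0) = Pi.single l 1 := by
          ext j
          simp [Pi.single_apply, eq_comm]
        rw [this]
        rfl
      set M := ∑ l, x l • A l with hM
      have hMT : Mᵀ = M := by
        rw [hM, transpose_sum]
        exact Finset.sum_congr rfl fun l _ => by rw [transpose_smul, (hA l).eq]
      have hMTB : M * (T * B) = M := by
        rw [hM, Finset.sum_mul]
        exact Finset.sum_congr rfl fun l _ => by rw [smul_mul_assoc, hATB]
      have hBTM : B * T * M = M := by
        have := congrArg transpose hMTB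
        rwa [transpose_mul, transpose_mul, hB, hT, hMT] at this
      have hfg : ∀ W, f (g W) = -(W * (T * M * T)).trace := by
        intro W
        have : (W * (T * M * T)).trace = (T * W * T * M).trace := by
          rw [← Matrix.mul_assoc, trace_mul_comm]
          simp only [Matrix.mul_assoc]
        rw [this, hf, hM, Finset.mul_sum, trace_sum, ← Finset.sum_neg_distrib]
        refine Finset.sum_congr rfl fun l _ => ?_
        rw [hgapp, Matrix.mul_smul, trace_smul, smul_eq_mul]
        ring
      have hpsd : (s • (1 : Matrix (Fin q) (Fin q) ℝ) + T * M * T).PosSemidef := by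
        refine PosSemidef.of_dotProduct_mulVec_nonneg ?_ fun z => ?_
        · simp [IsHermitian, transpose_mul, hT, hMT, Matrix.mul_assoc]
        · rcases eq_or_ne z 0 with rfl | hz
          · simp
          have hzz : 0 < z ⬝ᵥ z := by
            simpa using dotProduct_star_self_pos_iff.mpr hz
          have := hfs (g ((z ⬝ᵥ z)⁻¹ • vecMulVec z z)) ⟨_, ⟨?_, ?_⟩, rfl⟩
          · rw [hfg, smul_mul_assoc, trace_smul, vecMulVec_mul, trace_vecMulVec, smul_eq_mul,
              dotProduct_comm z (z ᵥ* _), ← dotProduct_mulVec] at this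
            have h2 := mul_lt_mul_of_pos_left this hzz
            rw [mul_neg, mul_inv_cancel_left₀ hzz.ne'] at h2
            simp only [star_trivial, add_mulVec, smul_mulVec, one_mulVec, dotProduct_add,
              dotProduct_smul, smul_eq_mul]
            linarith
          · exact (by simpa using posSemidef_vecMulVec_self_star z :
              (vecMulVec z z).PosSemidef).smul (inv_nonneg.mpr hzz.le)
          · rw [trace_smul, trace_vecMulVec, smul_eq_mul, inv_mul_cancel₀ hzz.ne']
      have hpsd2 : (s • A0 + M).PosSemidef := by
        have := hpsd.conjTranspose_mul_mul_same B
        have e : Bᴴ * (s • (1 : Matrix (Fin q) (Fin q) ℝ) + T * M * T) * B = s • A0 + M := by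
          rw [conjTranspose_eq_transpose_of_trivial, hB, Matrix.mul_add, Matrix.add_mul,
            Matrix.mul_smul, Matrix.mul_one, Matrix.smul_mul, hBB, ← Matrix.mul_assoc,
            ← Matrix.mul_assoc, hBTM, Matrix.mul_assoc, hMTB]
        rwa [e] at this
      have hxK : s⁻¹ • x ∈ K := by
        have := hpsd2.smul (inv_nonneg.mpr hs.le)
        rw [smul_add, inv_smul_smul₀ hs.ne', hM, Finset.smul_sum] at this
        simpa [hK, smul_smul] using this
      have h := hu _ hxK
      have e : ∑ l, u l * (s⁻¹ • x) l = s⁻¹ * f u := by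
        rw [hf, Finset.mul_sum]
        exact Finset.sum_congr rfl fun l _ => by simp only [Pi.smul_apply, smul_eq_mul]; ring
      rw [e, inv_mul_le_iff₀ hs] at h
      linarith
    obtain ⟨W, ⟨hW, hWt⟩, rfl⟩ := hmem
    have hU : (T * W * T).PosSemidef := by
      simpa [hT] using hW.mul_mul_conjTranspose_same T
    refine ⟨T * W * T, hU, ?_, ?_⟩
    · have h := hW.trace_mul_nonneg hT1
      have e : (W * (T * A0 * T)).trace = (T * W * T * A0).trace := by
        rw [← Matrix.mul_assoc, trace_mul_comm]
        simp only [Matrix.mul_assoc]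
      rw [Matrix.mul_sub, trace_sub, Matrix.mul_one, e] at h
      rw [tipR_eq_trace hU]
      linarith
    · ext l
      rw [tipR_eq_trace hU, hgapp]
  · rintro ⟨U, hU, hU0, rfl⟩ x hx
    rw [hK] at hx
    have h := hU.trace_mul_nonneg hx
    rw [Matrix.mul_add, trace_add, Finset.mul_sum, trace_sum] at h
    simp only [Matrix.mul_smul, trace_smul, smul_eq_mul] at h
    simp only [tipR_eq_trace hU, neg_mul, Finset.sum_neg_distrib] at hU0 ⊢
    simp only [mul_comm (x _)] at h
    linarith

end
end

section
/- Let G(x) = A_0 + x_1 A_1 + ... + x_n A_n with A_0,...,A_n q×q symmetric real matrices, K = {x ∈ ℝ^n : G(x) ⪰ 0}, and suppose K is compact and u is an interior point of K. If β(x) = β_0 + β_1 x_1 + ... + β_n x_n (β_i ∈ ℝ) satisfies β(x) ≥ 0 for all x ∈ K, then there exist a q×q positive semidefinite real matrix U and a real number γ with 0 ≤ γ ≤ β(u) such that β(x) = ⟨U, G(x)⟩ + γ identically as polynomials in x. -/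
open scoped BigOperators

noncomputable section

section

open Matrix Topology
open scoped MatrixOrder

/-- If a matrix and its negative perturb `H` to positive semidefinite matrices, then it
vanishes on the kernel of `H`. -/
lemma mulVec_eq_zero_of_posSemidef_add_sub {ι : Type*} [Fintype ι] {H D : Matrix ι ι ℝ}
    (hadd : (H + D).PosSemidef) (hsub : (H - D).PosSemidef) {v : ι → ℝ} (hv : H *ᵥ v = 0) :
    D *ᵥ v = 0 := by
  have h1 := hadd.dotProduct_mulVec_nonneg v
  have h2 := hsub.dotProduct_mulVec_nonneg v
  simp only [add_mulVec, sub_mulVec, hv, zero_add, zero_sub, dotProduct_neg] at h1 h2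
  have h3 := (hadd.dotProduct_mulVec_zero_iff v).1 (by
    rw [add_mulVec, hv, zero_add]; linarith)
  simpa [add_mulVec, hv] using h3

/-- A positive semidefinite form that is definite on a subspace dominates, up to scaling, any
other form on that subspace. -/
lemma exists_forall_ge_quadForm_nonneg {ι : Type*} [Fintype ι] {H : Matrix ι ι ℝ}
    (hH : H.PosSemidef) (W : Submodule ℝ (ι → ℝ)) (hW : ∀ v ∈ W, H *ᵥ v = 0 → v = 0)
    (M : Matrix ι ι ℝ) :
    ∃ c₀ : ℝ, ∀ c, c₀ ≤ c → ∀ v ∈ W, 0 ≤ v ⬝ᵥ ((c • H + M) *ᵥ v) := by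
  have hpos : ∀ v ∈ W, v ≠ 0 → 0 < v ⬝ᵥ (H *ᵥ v) := fun v hv hv0 =>
    lt_of_le_of_ne (hH.dotProduct_mulVec_nonneg v) fun h =>
      hv0 (hW v hv ((hH.dotProduct_mulVec_zero_iff v).1 h.symm))
  have hcont : ∀ N : Matrix ι ι ℝ, Continuous fun v : ι → ℝ => v ⬝ᵥ (N *ᵥ v) := fun N =>
    continuous_id.dotProduct (continuous_const.matrix_mulVec continuous_id)
  have hcomp : IsCompact (Metric.sphere (0 : ι → ℝ) 1 ∩ W) :=
    (isCompact_sphere 0 1).inter_right W.closed_of_finiteDimensional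
  have hne : ∀ v ∈ Metric.sphere (0 : ι → ℝ) 1 ∩ W, v ⬝ᵥ (H *ᵥ v) ≠ 0 := fun v hv =>
    (hpos v hv.2 (ne_zero_of_mem_unit_sphere ⟨v, hv.1⟩)).ne'
  obtain ⟨C, hC⟩ := hcomp.exists_bound_of_continuousOn
    ((hcont M).continuousOn.div (hcont H).continuousOn hne)
  refine ⟨C, fun c hCc v hv => ?_⟩
  rcases eq_or_ne v 0 with rfl | hv0
  · simp
  have hn : 0 < ‖v‖ := norm_pos_iff.2 hv0
  have hw : ‖v‖⁻¹ • v ∈ Metric.sphere (0 : ι → ℝ) 1 ∩ W :=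
    ⟨by simp [norm_smul, hn.ne'], W.smul_mem _ hv⟩
  have hb := (abs_le.1 (hC _ hw)).1
  simp only [Pi.div_apply, mulVec_smul, dotProduct_smul, smul_dotProduct, smul_eq_mul] at hb
  rw [mul_div_mul_left _ _ (inv_ne_zero hn.ne'), mul_div_mul_left _ _ (inv_ne_zero hn.ne'),
    le_div_iff₀ (hpos v hv hv0)] at hb
  have := mul_le_mul_of_nonneg_right hCc (hpos v hv hv0).le
  simp only [add_mulVec, smul_mulVec, dotProduct_add, dotProduct_smul, smul_eq_mul]
  linarith

/-- A linear functional that is nonnegative on positive semidefinite matrices is represented on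
symmetric matrices by a positive semidefinite matrix. -/
lemma exists_posSemidef_forall_eq_tipR {ι : Type*} [Fintype ι]
    (g : Matrix ι ι ℝ →ₗ[ℝ] ℝ) (hg : ∀ S : Matrix ι ι ℝ, S.PosSemidef → 0 ≤ g S) :
    ∃ U : Matrix ι ι ℝ, U.PosSemidef ∧ ∀ S : Matrix ι ι ℝ, S.IsSymm → g S = tipR U S := by
  classical
  have hsum : ∀ S : Matrix ι ι ℝ, g S = ∑ i, ∑ j, g (single i j 1) * S i j := fun S => by
    conv_lhs => rw [matrix_eq_sum_single S]
    simp only [map_sum]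
    refine Finset.sum_congr rfl fun i _ => Finset.sum_congr rfl fun j _ => ?_
    rw [← mul_one (S i j), ← smul_eq_mul, ← smul_single, map_smul]
    simp [mul_comm]
  let U : Matrix ι ι ℝ := of fun i j => (g (single i j 1) + g (single j i 1)) / 2
  have hU : ∀ S : Matrix ι ι ℝ, S.IsSymm → g S = tipR U S := fun S hS => by
    have hswap : ∑ i, ∑ j, g (single j i 1) * S i j = g S := by
      rw [Finset.sum_comm, hsum S]
      simp only [hS.apply]
    have : tipR U S = (∑ i, ∑ j, g (single i j 1) * S i j
        + ∑ i, ∑ j, g (single j i 1) * S i j) / 2 := by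
      simp only [tipR, U, of_apply, ← Finset.sum_add_distrib, Finset.sum_div]
      refine Finset.sum_congr rfl fun i _ => Finset.sum_congr rfl fun j _ => ?_
      ring
    rw [this, hswap, ← hsum]
    ring
  refine ⟨U, .of_dotProduct_mulVec_nonneg ?_ fun v => ?_, hU⟩
  · ext i j
    simp [U, add_comm]
  · have h1 : (vecMulVec v v).PosSemidef := by
      simpa using posSemidef_vecMulVec_self_star v
    have h2 := hg _ h1
    rw [hU _ (by ext i j; simp [vecMulVec_apply, mul_comm])] at h2
    refine h2.trans_eq ?_
    simp only [tipR, dotProduct, mulVec, vecMulVec_apply, Finset.mul_sum, star_trivial]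
    refine Finset.sum_congr rfl fun i _ => Finset.sum_congr rfl fun j _ => ?_
    ring

/-- The trace inner product is linear in its second argument. -/
def tipRLinearMap {ι : Type*} [Fintype ι] (U : Matrix ι ι ℝ) : Matrix ι ι ℝ →ₗ[ℝ] ℝ where
  toFun := tipR U
  map_add' S T := by simp [tipR, mul_add, Finset.sum_add_distrib]
  map_smul' c S := by
    simp only [tipR, Matrix.smul_apply, smul_eq_mul, Finset.mul_sum, RingHom.id_apply]
    refine Finset.sum_congr rfl fun i _ => Finset.sum_congr rfl fun j _ => ?_
    ring

/-- The trace inner product of two positive semidefinite matrices is nonnegative. -/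
lemma tipR_nonneg {ι : Type*} [Fintype ι] {U S : Matrix ι ι ℝ}
    (hU : U.PosSemidef) (hS : S.PosSemidef) : 0 ≤ tipR U S := by
  classical
  obtain ⟨B, rfl⟩ := CStarAlgebra.nonneg_iff_eq_star_mul_self.1 hS.nonneg
  have : tipR U (Bᴴ * B) = ∑ k, star (B k) ⬝ᵥ (U *ᵥ B k) := by
    simp only [tipR, dotProduct, mulVec, mul_apply, conjTranspose_apply, star_trivial,
      Finset.mul_sum]
    conv_rhs => rw [Finset.sum_comm]
    refine Finset.sum_congr rfl fun i _ => ?_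
    conv_rhs => rw [Finset.sum_comm]
    refine Finset.sum_congr rfl fun j _ => Finset.sum_congr rfl fun k _ => ?_
    ring
  rw [star_eq_conjTranspose, this]
  exact Finset.sum_nonneg fun k _ => hU.dotProduct_mulVec_nonneg _

/-- The homogenized pencil `(t, y) ↦ t A₀ + ∑ yₗ Aₗ`. -/
def pencil {κ ι : Type*} [Fintype κ] (A0 : Matrix ι ι ℝ) (A : κ → Matrix ι ι ℝ) :
    ℝ × (κ → ℝ) →ₗ[ℝ] Matrix ι ι ℝ :=
  (LinearMap.toSpanSingleton ℝ _ A0).coprod (Fintype.linearCombination ℝ A)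

lemma pencil_apply {κ ι : Type*} [Fintype κ] (A0 : Matrix ι ι ℝ) (A : κ → Matrix ι ι ℝ)
    (t : ℝ) (y : κ → ℝ) : pencil A0 A (t, y) = t • A0 + ∑ l, y l • A l := by
  simp [pencil, Fintype.linearCombination_apply]

lemma pencil_isSymm {κ ι : Type*} [Fintype κ] {A0 : Matrix ι ι ℝ} {A : κ → Matrix ι ι ℝ}
    (hA0 : A0.IsSymm) (hA : ∀ l, (A l).IsSymm) (p : ℝ × (κ → ℝ)) : (pencil A0 A p).IsSymm := by
  obtain ⟨t, y⟩ := p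
  simp only [IsSymm, pencil_apply, transpose_add, transpose_smul, transpose_sum, hA0.eq,
    fun l => (hA l).eq]

/-- The kernel of `G(u)`, for `u` an interior point, is contained in the kernel of every value
of the homogenized pencil. -/
lemma pencil_mulVec_eq_zero {κ ι : Type*} [Fintype κ] [Fintype ι] {A0 : Matrix ι ι ℝ}
    {A : κ → Matrix ι ι ℝ} {u : κ → ℝ}
    (hu : u ∈ interior {x | (pencil A0 A (1, x)).PosSemidef}) {v : ι → ℝ}
    (hv : pencil A0 A (1, u) *ᵥ v = 0) (p : ℝ × (κ → ℝ)) : pencil A0 A p *ᵥ v = 0 := by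
  have hdir : ∀ y, pencil A0 A (0, y) *ᵥ v = 0 := fun y => by
    have hcont : Continuous fun ε : ℝ => u + ε • y := by fun_prop
    have hu0 : {x | (pencil A0 A (1, x)).PosSemidef} ∈ 𝓝 (u + (0 : ℝ) • y) := by
      rw [zero_smul, add_zero]
      exact mem_interior_iff_mem_nhds.1 hu
    have hnhds : ∀ᶠ ε in 𝓝 (0 : ℝ), (pencil A0 A (1, u + ε • y)).PosSemidef :=
      hcont.continuousAt.preimage_mem_nhds hu0
    obtain ⟨δ, hδ, hball⟩ := Metric.eventually_nhds_iff.1 hnhds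
    have hδ2 : 0 < δ / 2 := half_pos hδ
    have hlt : |δ / 2| < δ := by rw [abs_of_pos hδ2]; linarith
    have h1 := hball (y := δ / 2) (by simpa only [dist_zero_right, Real.norm_eq_abs] using hlt)
    have h2 := hball (y := -(δ / 2)) (by
      simpa only [dist_zero_right, norm_neg, Real.norm_eq_abs] using hlt)
    have e1 : ((1 : ℝ), u + (δ / 2) • y) = (1, u) + (δ / 2) • (0, y) := by simp
    have e2 : ((1 : ℝ), u + (-(δ / 2)) • y) = (1, u) - (δ / 2) • (0, y) := by
      simp [sub_eq_add_neg]
    rw [e1, map_add, map_smul] at h1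
    rw [e2, map_sub, map_smul] at h2
    have h3 := mulVec_eq_zero_of_posSemidef_add_sub h1 h2 hv
    rw [smul_mulVec] at h3
    exact (smul_eq_zero.1 h3).resolve_left hδ2.ne'
  obtain ⟨t, y⟩ := p
  have e : (t, y) = t • ((1 : ℝ), u) + (0, y - t • u) := by simp
  rw [e, map_add, map_smul, add_mulVec, smul_mulVec, hv, hdir, smul_zero, zero_add]

/-- The recession cone of a bounded spectrahedron is trivial. -/
lemma eq_zero_of_pencil_zero_posSemidef {κ ι : Type*} [Fintype κ] [Fintype ι]
    {A0 : Matrix ι ι ℝ} {A : κ → Matrix ι ι ℝ}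
    (hb : Bornology.IsBounded {x | (pencil A0 A (1, x)).PosSemidef})
    {u y : κ → ℝ} (hu : (pencil A0 A (1, u)).PosSemidef)
    (hy : (pencil A0 A (0, y)).PosSemidef) : y = 0 := by
  by_contra hy0
  have hn : 0 < ‖y‖ := norm_pos_iff.2 hy0
  obtain ⟨R, hR⟩ := hb.exists_norm_le
  have hmem : ∀ τ : ℝ, 0 ≤ τ → ‖u + τ • y‖ ≤ R := fun τ hτ => hR _ (by
    have e : ((1 : ℝ), u + τ • y) = (1, u) + τ • (0, y) := by simp
    rw [Set.mem_ofPred_eq, e, map_add, map_smul]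
    exact hu.add (hy.smul hτ))
  have hR0 : 0 ≤ R := (norm_nonneg _).trans (hmem 0 le_rfl)
  have hτ : 0 ≤ (R + ‖u‖ + 1) / ‖y‖ := by positivity
  have h1 := hmem _ hτ
  have h2 := norm_sub_le (u + ((R + ‖u‖ + 1) / ‖y‖) • y) u
  rw [add_sub_cancel_left, norm_smul, Real.norm_of_nonneg hτ, div_mul_cancel₀ _ hn.ne'] at h2
  linarith

/-- The pairs `(S, p)` such that `S` plus the value of a linear map at `p` has a nonnegative
quadratic form on the subspace `W`, and the first component of `p` is nonnegative. -/
def shiftedCone {κ ι : Type*} [Fintype ι] (P : ℝ × (κ → ℝ) →ₗ[ℝ] Matrix ι ι ℝ)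
    (W : Submodule ℝ (ι → ℝ)) : PointedCone ℝ (Matrix ι ι ℝ × ℝ × (κ → ℝ)) where
  carrier := {z | (∀ v ∈ W, 0 ≤ v ⬝ᵥ ((z.1 + P z.2) *ᵥ v)) ∧ 0 ≤ z.2.1}
  add_mem' := by
    rintro a b ⟨ha, ha'⟩ ⟨hb, hb'⟩
    refine ⟨fun v hv => ?_, add_nonneg ha' hb'⟩
    have e : (a + b).1 + P (a + b).2 = (a.1 + P a.2) + (b.1 + P b.2) := by
      simp only [Prod.fst_add, Prod.snd_add, map_add]; abel
    rw [e, add_mulVec, dotProduct_add]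
    exact add_nonneg (ha v hv) (hb v hv)
  zero_mem' := by simp
  smul_mem' := by
    rintro ⟨c, hc⟩ a ⟨ha, ha'⟩
    refine ⟨fun v hv => ?_, mul_nonneg hc ha'⟩
    change 0 ≤ v ⬝ᵥ ((c • a.1 + P (c • a.2)) *ᵥ v)
    rw [map_smul, ← smul_add, smul_mulVec, dotProduct_smul]
    exact mul_nonneg hc (ha v hv)

/-- A linear functional that is nonnegative wherever the homogenized pencil is positive
semidefinite and `t ≥ 0` is a conic combination of `t` and the pencil. -/
lemma exists_posSemidef_forall_eq_tipR_pencil {κ ι : Type*} [Fintype κ] [Fintype ι]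
    {A0 : Matrix ι ι ℝ} {A : κ → Matrix ι ι ℝ} (hA0 : A0.IsSymm) (hA : ∀ l, (A l).IsSymm)
    {u : κ → ℝ} (hu : u ∈ interior {x | (pencil A0 A (1, x)).PosSemidef})
    (F : ℝ × (κ → ℝ) →ₗ[ℝ] ℝ)
    (hF : ∀ p, (pencil A0 A p).PosSemidef → 0 ≤ p.1 → 0 ≤ F p) :
    ∃ (U : Matrix ι ι ℝ) (γ : ℝ), U.PosSemidef ∧ 0 ≤ γ ∧
      ∀ p, F p = tipR U (pencil A0 A p) + γ * p.1 := by
  set P := pencil A0 A with hP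
  have hH : (P (1, u)).PosSemidef := by
    simpa only [Set.mem_ofPred_eq] using interior_subset hu
  have hsymm : ∀ p, (P p).IsSymm := pencil_isSymm hA0 hA
  obtain ⟨W, hW⟩ := (LinearMap.ker (P (1, u)).mulVecLin).exists_isCompl
  have hWker : ∀ v ∈ W, P (1, u) *ᵥ v = 0 → v = 0 := fun v hv h0 =>
    (Submodule.disjoint_def.1 hW.disjoint) v (by simpa using h0) hv
  have hPW : ∀ p, (∀ v ∈ W, 0 ≤ v ⬝ᵥ (P p *ᵥ v)) → (P p).PosSemidef := fun p hp => by
    refine .of_dotProduct_mulVec_nonneg (by simpa [IsHermitian] using (hsymm p).eq) fun x => ?_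
    obtain ⟨k, w, hk, hw, rfl⟩ := Submodule.codisjoint_iff_exists_add_eq.1 hW.codisjoint x
    have hk0 : P p *ᵥ k = 0 := pencil_mulVec_eq_zero hu (by simpa using hk) p
    have hk1 : k ᵥ* P p = 0 := by rw [← mulVec_transpose, (hsymm p).eq, hk0]
    rw [star_trivial, mulVec_add, hk0, zero_add, add_dotProduct, dotProduct_mulVec k, hk1,
      zero_dotProduct, zero_add]
    exact hp w hw
  let f : (Matrix ι ι ℝ × ℝ × (κ → ℝ)) →ₗ.[ℝ] ℝ :=
    { domain := LinearMap.ker (LinearMap.fst ℝ (Matrix ι ι ℝ) (ℝ × (κ → ℝ)))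
      toFun := (F ∘ₗ LinearMap.snd ℝ _ _).domRestrict _ }
  obtain ⟨g, hgf, hg⟩ := riesz_extension (shiftedCone P W) f
    (by
      rintro ⟨⟨S, p⟩, hS⟩ ⟨h1, h2⟩
      obtain rfl : S = 0 := hS
      exact hF p (hPW p (by simpa using h1)) h2)
    (by
      rintro ⟨S, p⟩
      obtain ⟨c₀, hc₀⟩ := exists_forall_ge_quadForm_nonneg hH W hWker (S + P p)
      let c := max c₀ (-p.1)
      refine ⟨⟨(0, c • (1, u)), rfl⟩, fun v hv => ?_, ?_⟩
      · convert hc₀ c (le_max_left _ _) v hv using 3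
        simp only [Prod.mk_add_mk, map_add, map_smul]
        abel
      · have : -p.1 ≤ c := le_max_right _ _
        simp
        linarith)
  have hg2 : ∀ p, g (0, p) = F p := fun p => hgf ⟨(0, p), rfl⟩
  obtain ⟨U, hU, hgU⟩ := exists_posSemidef_forall_eq_tipR (g ∘ₗ LinearMap.inl ℝ _ _)
    fun S hS => hg (S, 0) ⟨fun v _ => by
      simpa using hS.dotProduct_mulVec_nonneg v, le_rfl⟩
  have hnonneg : ∀ p : ℝ × (κ → ℝ), 0 ≤ p.1 → tipR U (P p) ≤ F p := fun p hp => by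
    have h1 := hg (-P p, p) ⟨fun v _ => by simp, hp⟩
    have e : ((-P p, p) : Matrix ι ι ℝ × ℝ × (κ → ℝ)) = (0, p) - (P p, 0) := by simp
    have h2 : g (P p, 0) = tipR U (P p) := hgU _ (hsymm p)
    rw [e, map_sub, hg2, h2] at h1
    linarith
  let d : ℝ × (κ → ℝ) →ₗ[ℝ] ℝ := F - tipRLinearMap U ∘ₗ P
  have hd : ∀ p : ℝ × (κ → ℝ), 0 ≤ p.1 → 0 ≤ d p := fun p hp => sub_nonneg.2 (hnonneg p hp)
  have hd0 : ∀ y, d (0, y) = 0 := fun y => by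
    have h1 := hd (0, y) le_rfl
    have h2 := hd (-(0, y)) (by simp)
    rw [map_neg] at h2
    linarith
  refine ⟨U, d (1, 0), hU, hd _ zero_le_one, fun p => ?_⟩
  have e : p = p.1 • ((1 : ℝ), (0 : κ → ℝ)) + (0, p.2) := by ext <;> simp
  have h1 : d p = d (1, 0) * p.1 := by
    conv_lhs => rw [e]
    rw [map_add, map_smul, hd0, add_zero, smul_eq_mul, mul_comm]
  rw [← h1]
  change F p = tipR U (P p) + (F p - tipR U (P p))
  ring

end

/-- If `K = {x : G(x) := A₀ + ∑ xₗ Aₗ ⪰ 0}` is compact, `u` is an interior point of `K`,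
and the affine polynomial `β(x) = β₀ + ∑ βₗ xₗ` is nonnegative on `K`, then there are a
positive semidefinite matrix `U` and `0 ≤ γ ≤ β(u)` with `β(x) = ⟨U, G(x)⟩ + γ`
identically in `x`. -/
theorem affine_nonneg_representation {n q : ℕ}
    (A0 : Matrix (Fin q) (Fin q) ℝ) (A : Fin n → Matrix (Fin q) (Fin q) ℝ)
    (hA0 : A0.IsSymm) (hA : ∀ l, (A l).IsSymm)
    (K : Set (Fin n → ℝ))
    (hK : K = {x | (A0 + ∑ l, x l • A l).PosSemidef})
    (hcomp : IsCompact K)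
    (u : Fin n → ℝ) (hu : u ∈ interior K)
    (β0 : ℝ) (β : Fin n → ℝ)
    (hβ : ∀ x ∈ K, 0 ≤ β0 + ∑ l, β l * x l) :
    ∃ (U : Matrix (Fin q) (Fin q) ℝ) (γ : ℝ),
      U.PosSemidef ∧ 0 ≤ γ ∧ γ ≤ β0 + ∑ l, β l * u l ∧
      ∀ x : Fin n → ℝ,
        β0 + ∑ l, β l * x l = tipR U (A0 + ∑ l, x l • A l) + γ := by
  subst hK
  have hG : ∀ x : Fin n → ℝ, A0 + ∑ l, x l • A l = pencil A0 A (1, x) := fun x => by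
    rw [pencil_apply, one_smul]
  simp only [hG] at *
  have hGu : (pencil A0 A (1, u)).PosSemidef := by
    simpa only [Set.mem_ofPred_eq] using interior_subset hu
  let F : ℝ × (Fin n → ℝ) →ₗ[ℝ] ℝ :=
    (LinearMap.toSpanSingleton ℝ ℝ β0).coprod (Fintype.linearCombination ℝ β)
  have hF1 : ∀ x, F (1, x) = β0 + ∑ l, β l * x l := fun x => by
    simp [F, Fintype.linearCombination_apply, mul_comm]
  obtain ⟨U, γ, hU, hγ, h⟩ := exists_posSemidef_forall_eq_tipR_pencil hA0 hA hu F (by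
    rintro ⟨t, y⟩ hp ht
    rcases (show 0 ≤ t from ht).eq_or_lt with rfl | ht
    · rw [eq_zero_of_pencil_zero_posSemidef hcomp.isBounded hGu hp]
      exact (map_zero F).ge
    · have e : (t, y) = t • ((1 : ℝ), t⁻¹ • y) := by simp [ht.ne']
      have e' : ((1 : ℝ), t⁻¹ • y) = t⁻¹ • (t, y) := by simp [ht.ne']
      rw [e, map_smul, hF1]
      refine mul_nonneg ht.le (hβ _ ?_)
      rw [Set.mem_ofPred_eq, e', map_smul]
      exact hp.smul (inv_nonneg.2 ht.le))
  have hx : ∀ x : Fin n → ℝ,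
      β0 + ∑ l, β l * x l = tipR U (pencil A0 A (1, x)) + γ := fun x => by
    rw [← hF1, h, mul_one]
  refine ⟨U, γ, hU, hγ, ?_, hx⟩
  rw [hx u]
  exact le_add_of_nonneg_left (tipR_nonneg hU hGu)

end
end

section
/- Let G(x) = A_0 + x_1 A_1 + ... + x_n A_n with A_0,...,A_n q×q symmetric real matrices, K = {x ∈ ℝ^n : G(x) ⪰ 0}, and let H(G) ⊆ ℝ[x_1,...,x_n] be the set of all polynomials of the form λ_0 + Σ_{k=1}^m ⟨Λ_k, G(x)^{⊗k}⟩ where m ∈ ℕ, λ_0 ≥ 0 is a real number, and each Λ_k is a q^k × q^k positive semidefinite real matrix. If K is compact with nonempty interior, then the constant polynomial 1 lies in the algebraic interior of the convex set H(G): for every f ∈ ℝ[x_1,...,x_n] there exists ε_f > 0 such that 1 + λf ∈ H(G) for all real λ with |λ| < ε_f. -/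
open scoped BigOperators

noncomputable section

/-- The `k`-fold Kronecker power of a matrix, with rows and columns indexed by
functions `Fin k → ι` (a type of cardinality `(#ι)^k`):
`(M^{⊗k})_{a,b} = ∏ᵢ M_{a i, b i}`. -/
def kronPow {ι : Type*} {R : Type*} [CommMonoid R] (M : Matrix ι ι R) (k : ℕ) :
    Matrix (Fin k → ι) (Fin k → ι) R :=
  Matrix.of fun a b => ∏ i, M (a i) (b i)

/-- Trace inner product `⟨Λ, B⟩ = tr(Λᵀ B) = ∑ᵢⱼ Λᵢⱼ Bᵢⱼ` of a real matrix against a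
polynomial matrix. -/
def tipP {n : ℕ} {ι : Type*} [Fintype ι] (Λ : Matrix ι ι ℝ)
    (B : Matrix ι ι (MvPolynomial (Fin n) ℝ)) : MvPolynomial (Fin n) ℝ :=
  ∑ i, ∑ j, MvPolynomial.C (Λ i j) * B i j

/-- The cone `H(G)` of all polynomials of the form
`λ₀ + ∑_{k=1}^m ⟨Λ_k, G(x)^{⊗k}⟩` with `λ₀ ≥ 0` and each `Λ_k` positive semidefinite. -/
def Hset {n : ℕ} {ι : Type*} [Fintype ι]
    (G : Matrix ι ι (MvPolynomial (Fin n) ℝ)) : Set (MvPolynomial (Fin n) ℝ) :=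
  { p | ∃ (m : ℕ) (lam0 : ℝ) (Λ : (k : ℕ) → Matrix (Fin k → ι) (Fin k → ι) ℝ),
      0 ≤ lam0 ∧ (∀ k ∈ Finset.Icc 1 m, (Λ k).PosSemidef) ∧
      p = MvPolynomial.C lam0 + ∑ k ∈ Finset.Icc 1 m, tipP (Λ k) (kronPow G k) }

/-- The linear polynomial matrix `G(x) = A₀ + ∑ₗ xₗ Aₗ`. -/
def linMat {n q : ℕ} (A0 : Matrix (Fin q) (Fin q) ℝ)
    (A : Fin n → Matrix (Fin q) (Fin q) ℝ) :
    Matrix (Fin q) (Fin q) (MvPolynomial (Fin n) ℝ) :=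
  Matrix.of fun i j =>
    MvPolynomial.C (A0 i j) + ∑ l, MvPolynomial.X l * MvPolynomial.C (A l i j)

/-- Entrywise evaluation of a polynomial matrix at a point `x`. -/
def evalMat {n : ℕ} {ι : Type*} (x : Fin n → ℝ)
    (B : Matrix ι ι (MvPolynomial (Fin n) ℝ)) : Matrix ι ι ℝ :=
  Matrix.of fun i j => MvPolynomial.eval x (B i j)

/-- A convex cone in a finite-dimensional real space on which no nonzero continuous linear
functional is nonpositive is the whole space. -/
theorem PointedCone.eq_top_of_forall_nonpos_imp_eq_zero {V : Type*} [NormedAddCommGroup V]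
    [NormedSpace ℝ V] [FiniteDimensional ℝ V] (E : PointedCone ℝ V)
    (h : ∀ f : V →L[ℝ] ℝ, (∀ e ∈ E, f e ≤ 0) → f = 0) : E = ⊤ := by
  have hconv : Convex ℝ (E : Set V) := E.convex
  have hdense : closure (E : Set V) = Set.univ := by
    by_contra hne
    obtain ⟨x, hx⟩ := (Set.ne_univ_iff_exists_notMem _).1 hne
    obtain ⟨f, u, hf, hfx⟩ := geometric_hahn_banach_closed_point hconv.closure isClosed_closure hx
    have hu : 0 < u := by simpa using hf 0 (subset_closure E.zero_mem)
    have hf0 : f = 0 := by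
      refine h f fun e he => ?_
      by_contra! hpos
      have hmem : (u / f e) • e ∈ E := E.smul_mem (by positivity) he
      have := hf _ (subset_closure hmem)
      rw [map_smul, smul_eq_mul, div_mul_cancel₀ _ hpos.ne'] at this
      exact lt_irrefl _ this
    rw [hf0] at hfx
    exact absurd hfx (not_lt.2 hu.le)
  have hspan : affineSpan ℝ (E : Set V) = ⊤ := by
    have hcl : IsClosed (affineSpan ℝ (E : Set V) : Set V) :=
      AffineSubspace.closed_of_finiteDimensional _
    have hsub := closure_minimal (subset_affineSpan ℝ (E : Set V)) hcl
    rw [hdense] at hsub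
    exact SetLike.coe_injective (Set.univ_subset_iff.1 hsub)
  have hint := hconv.interior_closure_eq_interior_of_nonempty_interior
    (hconv.interior_nonempty_iff_affineSpan_eq_top.2 hspan)
  rw [hdense, interior_univ] at hint
  exact SetLike.coe_injective (Set.univ_subset_iff.1 (hint.trans_subset interior_subset))

section tipP

variable {n : ℕ} {ι : Type*} [Fintype ι]

theorem tipP_add (Λ M : Matrix ι ι ℝ) (B : Matrix ι ι (MvPolynomial (Fin n) ℝ)) :
    tipP (Λ + M) B = tipP Λ B + tipP M B := by
  simp [tipP, add_mul, Finset.sum_add_distrib]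

@[simp]
theorem tipP_zero (B : Matrix ι ι (MvPolynomial (Fin n) ℝ)) : tipP 0 B = 0 := by
  simp [tipP]

theorem tipP_kronPow_zero (G : Matrix ι ι (MvPolynomial (Fin n) ℝ))
    (Λ : Matrix (Fin 0 → ι) (Fin 0 → ι) ℝ) :
    tipP Λ (kronPow G 0) = MvPolynomial.C (Λ default default) := by
  simp [tipP, kronPow, Subsingleton.elim _ (default : Fin 0 → ι)]

theorem tipP_kronPow_one (G : Matrix ι ι (MvPolynomial (Fin n) ℝ)) (M : Matrix ι ι ℝ) :
    tipP (M.submatrix (fun a : Fin 1 → ι => a 0) (fun a => a 0)) (kronPow G 1) = tipP M G := by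
  simp only [tipP, kronPow]
  refine Fintype.sum_equiv (Equiv.funUnique (Fin 1) ι) _ _ fun a => ?_
  refine Fintype.sum_equiv (Equiv.funUnique (Fin 1) ι) _ _ fun b => ?_
  simp

/-- The product of two terms of `H(G)` of degrees `k` and `l` is a term of degree `k + l`. -/
theorem exists_tipP_kronPow_mul (G : Matrix ι ι (MvPolynomial (Fin n) ℝ)) {k l : ℕ}
    {Λ : Matrix (Fin k → ι) (Fin k → ι) ℝ} {M : Matrix (Fin l → ι) (Fin l → ι) ℝ}
    (hΛ : Λ.PosSemidef) (hM : M.PosSemidef) :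
    ∃ N : Matrix (Fin (k + l) → ι) (Fin (k + l) → ι) ℝ, N.PosSemidef ∧
      tipP Λ (kronPow G k) * tipP M (kronPow G l) = tipP N (kronPow G (k + l)) := by
  refine ⟨(Matrix.kroneckerMap (· * ·) Λ M).submatrix (Fin.appendEquiv k l).symm
    (Fin.appendEquiv k l).symm, (hΛ.kronecker hM).submatrix _, ?_⟩
  have hR : ∀ F : (Fin (k + l) → ι) → (Fin (k + l) → ι) → MvPolynomial (Fin n) ℝ,
      ∑ a, ∑ b, F a b = ∑ a₁, ∑ a₂, ∑ b₁, ∑ b₂, F (Fin.append a₁ a₂) (Fin.append b₁ b₂) := by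
    intro F
    rw [← (Fin.appendEquiv k l).sum_comp, Fintype.sum_prod_type]
    refine Finset.sum_congr rfl fun a₁ _ => Finset.sum_congr rfl fun a₂ _ => ?_
    rw [← (Fin.appendEquiv k l).sum_comp, Fintype.sum_prod_type]
    rfl
  simp only [tipP]
  rw [hR]
  simp_rw [Finset.sum_mul_sum]
  refine Finset.sum_congr rfl fun a₁ _ => Finset.sum_congr rfl fun a₂ _ =>
    Finset.sum_congr rfl fun b₁ _ => Finset.sum_congr rfl fun b₂ _ => ?_
  simp [kronPow, Fin.prod_univ_add]
  ring

end tipP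

section Hset

variable {n : ℕ} {ι : Type*} [Fintype ι] {G : Matrix ι ι (MvPolynomial (Fin n) ℝ)}

theorem C_mem_Hset {r : ℝ} (hr : 0 ≤ r) : MvPolynomial.C r ∈ Hset G :=
  ⟨0, r, 0, hr, by simp, by simp⟩

theorem tipP_mem_Hset {k : ℕ} {Λ : Matrix (Fin k → ι) (Fin k → ι) ℝ} (hΛ : Λ.PosSemidef) :
    tipP Λ (kronPow G k) ∈ Hset G := by
  rcases Nat.eq_zero_or_pos k with rfl | hk
  · rw [tipP_kronPow_zero]
    exact C_mem_Hset hΛ.diag_nonneg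
  · refine ⟨k, 0, Function.update 0 k Λ, le_rfl, fun j _ => ?_, ?_⟩
    · by_cases hj : j = k
      · subst hj
        simpa using hΛ
      · simpa [Function.update_of_ne hj] using Matrix.PosSemidef.zero
    · rw [Finset.sum_eq_single k]
      · simp
      · intro j _ hj
        simp [Function.update_of_ne hj]
      · intro hk'
        exact absurd (Finset.mem_Icc.2 ⟨hk, le_rfl⟩) hk'

theorem add_mem_Hset {p r : MvPolynomial (Fin n) ℝ} (hp : p ∈ Hset G) (hr : r ∈ Hset G) :
    p + r ∈ Hset G := by
  have pad : ∀ {m m' : ℕ} (_ : m ≤ m') (Λ : (k : ℕ) → Matrix (Fin k → ι) (Fin k → ι) ℝ),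
      ∑ k ∈ Finset.Icc 1 m', tipP (if k ≤ m then Λ k else 0) (kronPow G k) =
        ∑ k ∈ Finset.Icc 1 m, tipP (Λ k) (kronPow G k) := by
    intro m m' hm Λ
    symm
    refine Finset.sum_subset_zero_on_sdiff (Finset.Icc_subset_Icc_right hm) ?_ ?_
    · intro k hk
      have : ¬ k ≤ m := by simp at hk; omega
      simp [this]
    · intro k hk
      simp [(Finset.mem_Icc.1 hk).2]
  obtain ⟨m, a, Λ, ha, hΛ, rfl⟩ := hp
  obtain ⟨m', b, M, hb, hM, rfl⟩ := hr
  refine ⟨max m m', a + b, fun k => (if k ≤ m then Λ k else 0) + (if k ≤ m' then M k else 0),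
    add_nonneg ha hb, fun k hk => ?_, ?_⟩
  · have hk1 := (Finset.mem_Icc.1 hk).1
    refine Matrix.PosSemidef.add ?_ ?_
    · split_ifs with h
      · exact hΛ k (Finset.mem_Icc.2 ⟨hk1, h⟩)
      · exact Matrix.PosSemidef.zero
    · split_ifs with h
      · exact hM k (Finset.mem_Icc.2 ⟨hk1, h⟩)
      · exact Matrix.PosSemidef.zero
  · simp_rw [tipP_add, Finset.sum_add_distrib, pad (le_max_left m m'), pad (le_max_right m m'),
      MvPolynomial.C_add]
    ring

theorem zero_mem_Hset : (0 : MvPolynomial (Fin n) ℝ) ∈ Hset G := by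
  simpa using C_mem_Hset (G := G) le_rfl

theorem mem_Hset_induction {P : MvPolynomial (Fin n) ℝ → Prop}
    (term : ∀ (k : ℕ) (Λ : Matrix (Fin k → ι) (Fin k → ι) ℝ), Λ.PosSemidef →
      P (tipP Λ (kronPow G k)))
    (zero : P 0) (add : ∀ p r, P p → P r → P (p + r))
    {p : MvPolynomial (Fin n) ℝ} (hp : p ∈ Hset G) : P p := by
  obtain ⟨m, a, Λ, ha, hΛ, rfl⟩ := hp
  refine add _ _ ?_ (Finset.sum_induction _ P add zero fun k hk => term k _ (hΛ k hk))
  have h := term 0 (Matrix.diagonal fun _ => a) (Matrix.PosSemidef.diagonal fun _ => ha)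
  rwa [tipP_kronPow_zero, Matrix.diagonal_apply_eq] at h

theorem mul_mem_Hset {p r : MvPolynomial (Fin n) ℝ} (hp : p ∈ Hset G) (hr : r ∈ Hset G) :
    p * r ∈ Hset G := by
  refine mem_Hset_induction (P := fun p => p * r ∈ Hset G) (fun k Λ hΛ => ?_) (by simpa using zero_mem_Hset)
    (fun p p' h h' => by simpa only [add_mul] using add_mem_Hset h h') hp
  refine mem_Hset_induction (P := fun r => tipP Λ (kronPow G k) * r ∈ Hset G)
    (fun l M hM => ?_) (by simpa using zero_mem_Hset)
    (fun r r' h h' => by simpa only [mul_add] using add_mem_Hset h h') hr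
  obtain ⟨N, hN, h⟩ := exists_tipP_kronPow_mul G hΛ hM
  rw [h]
  exact tipP_mem_Hset hN

variable (G) in
/-- A polynomial `f` is bounded with respect to `H(G)` if `N ± f ∈ H(G)` for some `N > 0`. -/
def IsHsetBounded (f : MvPolynomial (Fin n) ℝ) : Prop :=
  ∃ N : ℝ, 0 < N ∧ MvPolynomial.C N + f ∈ Hset G ∧ MvPolynomial.C N - f ∈ Hset G

theorem isHsetBounded_C (a : ℝ) : IsHsetBounded G (MvPolynomial.C a) := by
  refine ⟨|a| + 1, by positivity, ?_, ?_⟩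
  · rw [← MvPolynomial.C_add]
    exact C_mem_Hset (by linarith [neg_abs_le a])
  · rw [← MvPolynomial.C_sub]
    exact C_mem_Hset (by linarith [le_abs_self a])

theorem IsHsetBounded.add {f g : MvPolynomial (Fin n) ℝ} (hf : IsHsetBounded G f)
    (hg : IsHsetBounded G g) : IsHsetBounded G (f + g) := by
  obtain ⟨N, hN, h₁, h₂⟩ := hf
  obtain ⟨M, hM, h₃, h₄⟩ := hg
  refine ⟨N + M, by positivity, ?_, ?_⟩
  · convert add_mem_Hset h₁ h₃ using 1
    rw [MvPolynomial.C_add]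
    ring
  · convert add_mem_Hset h₂ h₄ using 1
    rw [MvPolynomial.C_add]
    ring

theorem IsHsetBounded.mul {f g : MvPolynomial (Fin n) ℝ} (hf : IsHsetBounded G f)
    (hg : IsHsetBounded G g) : IsHsetBounded G (f * g) := by
  obtain ⟨N, hN, h₁, h₂⟩ := hf
  obtain ⟨M, hM, h₃, h₄⟩ := hg
  have hC : (MvPolynomial.C (2⁻¹ : ℝ) : MvPolynomial (Fin n) ℝ) * 2 = 1 := by
    rw [show (2 : MvPolynomial (Fin n) ℝ) = MvPolynomial.C 2 from (map_ofNat _ 2).symm,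
      ← MvPolynomial.C_mul]
    norm_num
  have hhalf : MvPolynomial.C (2⁻¹ : ℝ) ∈ Hset G := C_mem_Hset (by norm_num)
  refine ⟨N * M, by positivity, ?_, ?_⟩
  · convert mul_mem_Hset hhalf (add_mem_Hset (mul_mem_Hset h₁ h₃) (mul_mem_Hset h₂ h₄)) using 1
    rw [MvPolynomial.C_mul]
    linear_combination (-(MvPolynomial.C N * MvPolynomial.C M + f * g)) * hC
  · convert mul_mem_Hset hhalf (add_mem_Hset (mul_mem_Hset h₁ h₄) (mul_mem_Hset h₂ h₃)) using 1
    rw [MvPolynomial.C_mul]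
    linear_combination (-(MvPolynomial.C N * MvPolynomial.C M - f * g)) * hC

theorem isHsetBounded_of_forall_X (hX : ∀ l, IsHsetBounded G (MvPolynomial.X l))
    (f : MvPolynomial (Fin n) ℝ) : IsHsetBounded G f :=
  MvPolynomial.induction_on f isHsetBounded_C (fun _ _ => IsHsetBounded.add)
    fun _ l hp => hp.mul (hX l)

theorem IsHsetBounded.exists_one_add_mem {f : MvPolynomial (Fin n) ℝ} (hf : IsHsetBounded G f) :
    ∃ ε : ℝ, 0 < ε ∧ ∀ lam : ℝ, |lam| < ε → 1 + MvPolynomial.C lam * f ∈ Hset G := by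
  obtain ⟨N, hN, h₁, h₂⟩ := hf
  refine ⟨1 / N, by positivity, fun lam hlam => ?_⟩
  have hle : 0 ≤ 1 - |lam| * N := by
    rw [lt_div_iff₀ hN] at hlam
    linarith
  have hc := C_mem_Hset (G := G) hle
  have ha := C_mem_Hset (G := G) (abs_nonneg lam)
  rcases abs_cases lam with ⟨h, _⟩ | ⟨h, _⟩
  · convert add_mem_Hset hc (mul_mem_Hset ha h₁) using 1
    rw [h, MvPolynomial.C_sub, MvPolynomial.C_mul, MvPolynomial.C_1]
    ring
  · convert add_mem_Hset hc (mul_mem_Hset ha h₂) using 1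
    rw [h, MvPolynomial.C_sub, MvPolynomial.C_mul, MvPolynomial.C_1, MvPolynomial.C_neg]
    ring

end Hset

section linMat

variable {n q : ℕ} {A0 : Matrix (Fin q) (Fin q) ℝ} {A : Fin n → Matrix (Fin q) (Fin q) ℝ}

theorem evalMat_linMat (x : Fin n → ℝ) : evalMat x (linMat A0 A) = A0 + ∑ l, x l • A l := by
  ext i j
  simp [evalMat, linMat, Matrix.sum_apply]

/-- The entrywise inner product of two real matrices. -/
def entryInner (Λ B : Matrix (Fin q) (Fin q) ℝ) : ℝ := ∑ i, ∑ j, Λ i j * B i j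

theorem tipP_linMat (Λ : Matrix (Fin q) (Fin q) ℝ) :
    tipP Λ (linMat A0 A) = MvPolynomial.C (entryInner Λ A0) +
      ∑ l, MvPolynomial.C (entryInner Λ (A l)) * MvPolynomial.X l := by
  simp only [tipP, linMat, entryInner, Matrix.of_apply, mul_add, Finset.sum_add_distrib, map_sum,
    MvPolynomial.C_mul, Finset.mul_sum, Finset.sum_mul]
  congr 1
  rw [Finset.sum_comm (s := (Finset.univ : Finset (Fin n)))]
  refine Finset.sum_congr rfl fun i _ => ?_
  rw [Finset.sum_comm (s := (Finset.univ : Finset (Fin n)))]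
  refine Finset.sum_congr rfl fun j _ => Finset.sum_congr rfl fun l _ => ?_
  ring

theorem entryInner_vecMulVec_star (v : Fin q → ℝ) (B : Matrix (Fin q) (Fin q) ℝ) :
    entryInner (Matrix.vecMulVec v (star v)) B = dotProduct (star v) (B.mulVec v) := by
  simp only [entryInner, Matrix.vecMulVec_apply, dotProduct, Matrix.mulVec, star_trivial,
    Finset.mul_sum]
  refine Finset.sum_congr rfl fun i _ => Finset.sum_congr rfl fun j _ => ?_
  ring

variable (A) in
/-- The cone of coefficient vectors `(⟨Λ, A l⟩)_l` with `Λ` positive semidefinite. -/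
def coeffCone : PointedCone ℝ (Fin n → ℝ) where
  carrier := {y | ∃ Λ : Matrix (Fin q) (Fin q) ℝ, Λ.PosSemidef ∧ ∀ l, y l = entryInner Λ (A l)}
  zero_mem' := ⟨0, Matrix.PosSemidef.zero, by simp [entryInner]⟩
  add_mem' := by
    rintro y z ⟨Λ, hΛ, hy⟩ ⟨M, hM, hz⟩
    exact ⟨Λ + M, hΛ.add hM, fun l => by
      simp [hy, hz, entryInner, add_mul, Finset.sum_add_distrib]⟩
  smul_mem' := by
    rintro ⟨c, hc⟩ y ⟨Λ, hΛ, hy⟩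
    exact ⟨c • Λ, hΛ.smul hc, fun l => by
      simp [hy, entryInner, Finset.mul_sum, mul_assoc]⟩

/-- A direction `y` with `∑ l, y l • A l ⪰ 0` is zero when the spectrahedron is nonempty and
bounded. -/
theorem eq_zero_of_posSemidef_sum {K : Set (Fin n → ℝ)}
    (hK : K = {x | (evalMat x (linMat A0 A)).PosSemidef}) (hb : Bornology.IsBounded K)
    (hne : K.Nonempty) {y : Fin n → ℝ} (hy : (∑ l, y l • A l).PosSemidef) : y = 0 := by
  obtain ⟨x, hx⟩ := hne
  obtain ⟨R, hR⟩ := hb.exists_norm_le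
  have hmem : ∀ t : ℝ, 0 ≤ t → x + t • y ∈ K := by
    intro t ht
    rw [hK, Set.mem_ofPred_eq] at hx ⊢
    convert hx.add (hy.smul ht) using 1
    simp only [evalMat_linMat, Pi.add_apply, Pi.smul_apply, add_smul, Finset.sum_add_distrib,
      Finset.smul_sum, smul_eq_mul, mul_smul, add_assoc]
  by_contra hy0
  have hpos : 0 < ‖y‖ := norm_pos_iff.2 hy0
  have hR0 : 0 ≤ R := (norm_nonneg x).trans (hR x hx)
  have ht : 0 ≤ (2 * R + 1) / ‖y‖ := by positivity
  have h₁ := hR _ (hmem _ ht)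
  have h₂ : ‖((2 * R + 1) / ‖y‖) • y‖ = 2 * R + 1 := by
    rw [norm_smul, Real.norm_of_nonneg ht, div_mul_cancel₀ _ hpos.ne']
  have h₃ := norm_sub_le (x + ((2 * R + 1) / ‖y‖) • y) x
  rw [add_sub_cancel_left, h₂] at h₃
  linarith [hR x hx]

theorem coeffCone_eq_top (hA : ∀ l, (A l).IsSymm) {K : Set (Fin n → ℝ)}
    (hK : K = {x | (evalMat x (linMat A0 A)).PosSemidef}) (hb : Bornology.IsBounded K)
    (hne : K.Nonempty) : coeffCone A = ⊤ := by
  refine PointedCone.eq_top_of_forall_nonpos_imp_eq_zero _ fun f hf => ?_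
  have hf_apply : ∀ e, f e = ∑ l, e l * f (Pi.single l 1) := fun e => by
    conv_lhs => rw [pi_eq_sum_univ' e]
    simp
  have hy : (fun l => -f (Pi.single l 1)) = 0 := by
    refine eq_zero_of_posSemidef_sum hK hb hne (.of_dotProduct_mulVec_nonneg ?_ fun v => ?_)
    · simp [Matrix.IsHermitian, Matrix.transpose_sum, fun l => (hA l).eq]
    · have h := hf (fun l => entryInner (Matrix.vecMulVec v (star v)) (A l))
        ⟨_, Matrix.posSemidef_vecMulVec_self_star v, fun _ => rfl⟩
      rw [hf_apply] at h
      simp only [entryInner_vecMulVec_star] at h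
      refine (neg_nonneg.2 h).trans_eq ?_
      rw [Matrix.sum_mulVec, dotProduct_sum, ← Finset.sum_neg_distrib]
      refine Finset.sum_congr rfl fun l _ => ?_
      rw [Matrix.smul_mulVec, dotProduct_smul, smul_eq_mul]
      ring
  ext e
  rw [hf_apply]
  simp [fun l => neg_eq_zero.1 (congrFun hy l)]

theorem exists_C_add_C_mul_X_mem_Hset (htop : coeffCone A = ⊤) (c : ℝ) (l : Fin n) :
    ∃ N : ℝ, MvPolynomial.C N + MvPolynomial.C c * MvPolynomial.X l ∈ Hset (linMat A0 A) := by
  have hmem : Pi.single l c ∈ coeffCone A := htop ▸ Submodule.mem_top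
  obtain ⟨Λ, hΛ, h⟩ := hmem
  refine ⟨entryInner Λ A0, ?_⟩
  convert tipP_mem_Hset (G := linMat A0 A)
    (hΛ.submatrix fun a : Fin 1 → Fin q => a 0) using 1
  rw [tipP_kronPow_one, tipP_linMat]
  simp [← h, Pi.single_apply, apply_ite, ite_mul]

theorem isHsetBounded_X (htop : coeffCone A = ⊤) (l : Fin n) :
    IsHsetBounded (linMat A0 A) (MvPolynomial.X l) := by
  obtain ⟨N, hN⟩ := exists_C_add_C_mul_X_mem_Hset (A0 := A0) htop 1 l
  obtain ⟨M, hM⟩ := exists_C_add_C_mul_X_mem_Hset (A0 := A0) htop (-1) l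
  refine ⟨|N| + |M| + 1, by positivity, ?_, ?_⟩
  · convert add_mem_Hset (C_mem_Hset (r := |N| + |M| + 1 - N)
      (by linarith [le_abs_self N, abs_nonneg M])) hN using 1
    simp only [map_add, map_sub, map_one]
    ring
  · convert add_mem_Hset (C_mem_Hset (r := |N| + |M| + 1 - M)
      (by linarith [le_abs_self M, abs_nonneg N])) hM using 1
    simp only [map_add, map_sub, map_one, map_neg]
    ring

end linMat

/-- If `K = {x : G(x) := A₀ + ∑ xₗ Aₗ ⪰ 0}` is compact with nonempty interior, then the
constant polynomial `1` is an algebraic interior point of the convex cone `H(G)`: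
for every polynomial `f` there is `ε > 0` with `1 + λ·f ∈ H(G)` whenever `|λ| < ε`. -/
theorem one_mem_algebraic_interior_Hset {n q : ℕ}
    (A0 : Matrix (Fin q) (Fin q) ℝ) (A : Fin n → Matrix (Fin q) (Fin q) ℝ)
    (hA0 : A0.IsSymm) (hA : ∀ l, (A l).IsSymm)
    (K : Set (Fin n → ℝ))
    (hK : K = {x | (evalMat x (linMat A0 A)).PosSemidef})
    (hcomp : IsCompact K)
    (hint : (interior K).Nonempty) :
    ∀ f : MvPolynomial (Fin n) ℝ, ∃ ε : ℝ, 0 < ε ∧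
      ∀ lam : ℝ, |lam| < ε →
        1 + MvPolynomial.C lam * f ∈ Hset (linMat A0 A) := by
  have htop := coeffCone_eq_top hA hK hcomp.isBounded (hint.mono interior_subset)
  exact fun f => (isHsetBounded_of_forall_X (isHsetBounded_X htop) f).exists_one_add_mem

end
end
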